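/- Let m ≥ 1 and let Π^j_{l₁,l₂} = Π^j_{l₂,l₁} (0 ≤ j, l₁, l₂ ≤ m) be real-analytic functions on a neighborhood of 0 in ℝ^{1+m}. Then there exist a neighborhood V of 0 and real-analytic functions X, Y¹, …, Y^m on V, whose Jacobian determinant Δ(x|y¹|⋯|y^m) is nonvanishing on V, such that the square functions satisfy □^j_{y^{l₁}y^{l₂}} = Π^j_{l₁,l₂} on V for all 0 ≤ j, l₁, l₂ ≤ m, if and only if the functions Π^j_{l₁,l₂} satisfy, on a neighborhood of 0, the quadratic compatibility conditions: ∂_{y^{l₃}}Π^j_{l₁,l₂} − ∂_{y^{l₂}}Π^j_{l₁,l₃} = −Σ_{k=0}^m Π^k_{l₁,l₂}·Π^j_{l₃,k} + Σ_{k=0}^m Π^k_{l₁,l₃}·Π^j_{l₂,k}, for all 0 ≤ j, l₁, l₂, l₃ ≤ m. -/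

import Mathlib

/-- Partial derivative in the direction of the `i`-th coordinate `y^i`
(with the convention `y⁰ ≡ x`) of a function on `ℝ^{1+m}`. -/
noncomputable def pd (m : ℕ) (i : Fin (m + 1)) (f : (Fin (m + 1) → ℝ) → ℝ) :
    (Fin (m + 1) → ℝ) → ℝ :=
  fun z => fderiv ℝ f z (Pi.single i 1)

/-- The Jacobian determinant `Δ(x|y¹|⋯|y^m)` of the family `Z = (X, Y¹, …, Y^m)`. -/
noncomputable def jacDet (m : ℕ) (Z : Fin (m + 1) → (Fin (m + 1) → ℝ) → ℝ)
    (z : Fin (m + 1) → ℝ) : ℝ :=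
  (Matrix.of fun i j => pd m j (Z i) z).det

/-- The modified determinant `Δ(x|⋯|^k y^{l₁}y^{l₂}|⋯|y^m)`. -/
noncomputable def jacDetRep (m : ℕ) (Z : Fin (m + 1) → (Fin (m + 1) → ℝ) → ℝ)
    (k l₁ l₂ : Fin (m + 1)) (z : Fin (m + 1) → ℝ) : ℝ :=
  (Matrix.of fun i j =>
    if j = k then pd m l₂ (pd m l₁ (Z i)) z else pd m j (Z i) z).det

/-- The square functions `□^k_{y^{l₁}y^{l₂}}`. -/
noncomputable def sqFn (m : ℕ) (Z : Fin (m + 1) → (Fin (m + 1) → ℝ) → ℝ)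
    (k l₁ l₂ : Fin (m + 1)) (z : Fin (m + 1) → ℝ) : ℝ :=
  jacDetRep m Z k l₁ l₂ z / jacDet m Z z

section AnalyticODE

open Set Filter Topology unitInterval

set_option maxSynthPendingDepth 3

variable {E F G : Type*} [NormedAddCommGroup E] [NormedSpace ℝ E]
  [NormedAddCommGroup F] [NormedSpace ℝ F] [NormedAddCommGroup G] [NormedSpace ℝ G]

/-- The continuous linear map sending `g` to the path `t ↦ t ^ n • g`. -/
noncomputable def monomialPath (G : Type*) [NormedAddCommGroup G] [NormedSpace ℝ G] (n : ℕ) :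
    G →L[ℝ] C(I, G) :=
  LinearMap.mkContinuous
    { toFun := fun g => ⟨fun t => (t : ℝ) ^ n • g, by fun_prop⟩
      map_add' := fun g h => by ext t; simp
      map_smul' := fun c g => by ext t; exact smul_comm _ _ _ } 1
    (fun g => by
      rw [ContinuousMap.norm_le _ (by positivity)]
      intro t
      have h1 : |(t : ℝ) ^ n| ≤ 1 := by
        rw [abs_pow, abs_of_nonneg t.2.1]
        exact pow_le_one₀ t.2.1 t.2.2
      simpa [norm_smul] using mul_le_mul_of_nonneg_right h1 (norm_nonneg g))

lemma monomialPath_apply (n : ℕ) (g : G) (t : I) : monomialPath G n g t = (t : ℝ) ^ n • g := rfl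

lemma norm_monomialPath_le (n : ℕ) : ‖monomialPath G n‖ ≤ 1 :=
  LinearMap.mkContinuous_norm_le _ zero_le_one _

/-- A function vanishing and analytic at the origin, restricted to the rays `t ↦ t • z` and divided
by `t`, is an analytic function of `z` with values in the Banach space of continuous paths. -/
lemma AnalyticAt.exists_analyticAt_path [CompleteSpace G] {f : E → G} (hf : AnalyticAt ℝ f 0)
    (hf0 : f 0 = 0) :
    ∃ h : E → C(I, G), AnalyticAt ℝ h 0 ∧ h 0 = 0 ∧
      ∀ᶠ z in 𝓝 0, ∀ t : I, (t : ℝ) • h z t = f ((t : ℝ) • z) := by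
  obtain ⟨p, r, hp⟩ := hf
  let q : FormalMultilinearSeries ℝ E C(I, G) := fun n =>
    (monomialPath G (n - 1)).compContinuousMultilinearMap (p n)
  have hq : p.radius ≤ q.radius := by
    refine FormalMultilinearSeries.radius_le_of_le fun n => ?_
    refine (ContinuousLinearMap.norm_compContinuousMultilinearMap_le _ _).trans ?_
    simpa using mul_le_mul_of_nonneg_right (norm_monomialPath_le (G := G) (n - 1))
      (norm_nonneg (p n))
  have hrq : r ≤ q.radius := hp.r_le.trans hq
  have hqs := q.hasFPowerSeriesOnBall (hp.r_pos.trans_le hrq)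
  have hp0 (v : Fin 0 → E) : p 0 v = 0 := by rw [hp.coeff_zero, hf0]
  refine ⟨q.sum, hqs.analyticAt, ?_, ?_⟩
  · rw [← hqs.coeff_zero (fun _ => 0)]
    simp [q, hp0]
  filter_upwards [Metric.eball_mem_nhds (0 : E) hp.r_pos] with z hz t
  have h1 := hqs.hasSum (Metric.eball_subset_eball hrq hz)
  have h2 := ((ContinuousMap.evalCLM ℝ t).hasSum h1).const_smul (t : ℝ)
  have htz : (t : ℝ) • z ∈ Metric.eball (0 : E) r := by
    rw [Metric.mem_eball, edist_zero_right] at hz ⊢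
    refine lt_of_le_of_lt ?_ hz
    rw [enorm_smul]
    have : ‖(t : ℝ)‖ₑ ≤ 1 := by
      rw [← ofReal_norm, Real.norm_of_nonneg t.2.1]
      exact ENNReal.ofReal_le_one.2 t.2.2
    simpa using mul_le_mul_left this ‖z‖ₑ
  have h3 := hp.hasSum htz
  rw [zero_add] at h3
  simp only [zero_add] at h2
  refine h2.unique ?_
  convert h3 using 2 with n
  rw [(p n).map_smul_univ (fun _ => (t : ℝ)) (fun _ => z)]
  rcases n with _ | n
  · simp [q, hp0]
  · simp [q, monomialPath_apply, smul_smul, pow_succ']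

lemma continuous_IccExtend_apply (a : C(I, F →L[ℝ] F)) (u : C(I, F)) :
    Continuous (IccExtend zero_le_one fun s : I => a s (u s)) :=
  Continuous.Icc_extend' (by fun_prop)

/-- The continuous path `t ↦ ∫ s in 0..t, a s (u s)`. -/
noncomputable def integralPath (a : C(I, F →L[ℝ] F)) (u : C(I, F)) : C(I, F) where
  toFun t := ∫ s in (0 : ℝ)..t, IccExtend zero_le_one (fun s : I => a s (u s)) s
  continuous_toFun := (intervalIntegral.continuous_primitive
    (fun x y => (continuous_IccExtend_apply a u).intervalIntegrable x y) 0).comp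
      continuous_subtype_val

/-- The Volterra operator `(a, u) ↦ (t ↦ ∫ s in 0..t, a s (u s))`. -/
noncomputable def volterra (F : Type*) [NormedAddCommGroup F] [NormedSpace ℝ F] :
    C(I, F →L[ℝ] F) →L[ℝ] C(I, F) →L[ℝ] C(I, F) :=
  LinearMap.mkContinuous₂
    (LinearMap.mk₂ ℝ (integralPath (F := F))
      (fun a b u => by
        ext t
        simpa [integralPath, IccExtend] using intervalIntegral.integral_add
          ((continuous_IccExtend_apply a u).intervalIntegrable 0 t)
          ((continuous_IccExtend_apply b u).intervalIntegrable 0 t))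
      (fun c a u => by
        ext t
        simp [integralPath, IccExtend])
      (fun a u v => by
        ext t
        simpa [integralPath, IccExtend] using intervalIntegral.integral_add
          ((continuous_IccExtend_apply a u).intervalIntegrable 0 t)
          ((continuous_IccExtend_apply a v).intervalIntegrable 0 t))
      (fun c a u => by
        ext t
        simp [integralPath, IccExtend])) 1
    (fun a u => by
      rw [LinearMap.mk₂_apply, ContinuousMap.norm_le _ (by positivity)]
      intro t
      have := intervalIntegral.norm_integral_le_of_norm_le_const (a := 0) (b := (t : ℝ))
        (f := IccExtend zero_le_one fun s : I => a s (u s)) (C := ‖a‖ * ‖u‖) (fun s _ =>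
          (a _).le_of_opNorm_le_of_le (a.norm_coe_le_norm _) (u.norm_coe_le_norm _))
      refine this.trans ?_
      rw [sub_zero, abs_of_nonneg t.2.1, one_mul]
      exact mul_le_of_le_one_right (by positivity) t.2.2)

/-- The singular radial linear equation `DU(z) z = b(z) U(z)` with `b` analytic and `b 0 = 0` has an
analytic solution near the origin, with arbitrary initial value. -/
lemma exists_analyticAt_radial [CompleteSpace F] {b : E → F →L[ℝ] F} (hb : AnalyticAt ℝ b 0)
    (hb0 : b 0 = 0) (u₀ : F) :
    ∃ U : E → F, AnalyticAt ℝ U 0 ∧ U 0 = u₀ ∧ ∀ᶠ z in 𝓝 0, fderiv ℝ U z z = b z (U z) := by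
  obtain ⟨h, hh, hh0, hhb⟩ := hb.exists_analyticAt_path hb0
  have hV : AnalyticAt ℝ (fun z => 1 - volterra F (h z)) 0 :=
    analyticAt_const.sub
      ((ContinuousLinearMap.analyticAt (E := C(I, F →L[ℝ] F)) (F := C(I, F) →L[ℝ] C(I, F))
        (volterra F) (h 0)).fun_comp hh)
  have hu0 : IsUnit (1 - volterra F (h 0)) := by simp [hh0]
  have hunit : ∀ᶠ z in 𝓝 (0 : E), IsUnit (1 - volterra F (h z)) :=
    hV.continuousAt.eventually_mem (s := {T | IsUnit T})
      ((Units.isOpen (R := C(I, F) →L[ℝ] C(I, F))).mem_nhds hu0)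
  let c : C(I, F) := ContinuousMap.const I u₀
  let u : E → C(I, F) := fun z => Ring.inverse (1 - volterra F (h z)) c
  have hu : AnalyticAt ℝ u 0 := by
    have h1 : AnalyticAt ℝ (fun z => Ring.inverse (1 - volterra F (h z))) 0 := by
      refine AnalyticAt.fun_comp ?_ hV
      exact analyticAt_inverse (𝕜 := ℝ) (A := C(I, F) →L[ℝ] C(I, F)) hu0.unit
    exact ((ContinuousLinearMap.apply ℝ C(I, F) c).analyticAt _).comp h1
  let U : E → F := fun z => u z 1
  have hU : AnalyticAt ℝ U 0 :=
    (ContinuousLinearMap.analyticAt (E := C(I, F)) (ContinuousMap.evalCLM ℝ (1 : I)) (u 0)).fun_comp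
      hu
  have hsol : ∀ z, IsUnit (1 - volterra F (h z)) → u z = c + volterra F (h z) (u z) := by
    intro z hz
    have := congrArg (fun T => T c) (Ring.mul_inverse_cancel _ hz)
    have h2 : u z - volterra F (h z) (u z) = c := this
    rw [← h2, sub_add_cancel]
  have huniq : ∀ z, IsUnit (1 - volterra F (h z)) → ∀ v, v = c + volterra F (h z) v → v = u z := by
    intro z hz v hv
    have := congrArg (fun T => T v) (Ring.inverse_mul_cancel _ hz)
    have h2 : (1 - volterra F (h z)) v = c := by
      nth_rewrite 1 [sub_apply, one_apply_eq_self, hv]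
      simp
    rw [mul_apply_eq_comp, h2, one_apply_eq_self] at this
    exact this.symm
  refine ⟨U, hU, ?_, ?_⟩
  · simp [U, u, hh0, c]
  have hray : ∀ z, IsUnit (1 - volterra F (h z)) → (∀ t : I, (t : ℝ) • h z t = b ((t : ℝ) • z)) →
      ∀ s : I, IsUnit (1 - volterra F (h ((s : ℝ) • z))) →
      (∀ t : I, (t : ℝ) • h ((s : ℝ) • z) t = b ((t : ℝ) • (s : ℝ) • z)) →
      U ((s : ℝ) • z) = u z s := by
    intro z hz hhz s hsz hhsz
    let v : C(I, F) := ⟨fun t => u z (s * t), by fun_prop⟩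
    have hv : v = c + volterra F (h ((s : ℝ) • z)) v := by
      ext t
      have h1 := congrArg (fun w : C(I, F) => w (s * t)) (hsol z hz)
      have h2 : v t = u₀ + ∫ r in (0 : ℝ)..(s * t : ℝ),
        IccExtend zero_le_one (fun r : I => h z r (u z r)) r := h1
      rw [h2]
      change _ = u₀ + ∫ r in (0 : ℝ)..t,
        IccExtend zero_le_one (fun r : I => h ((s : ℝ) • z) r (v r)) r
      congr 1
      have h3 := intervalIntegral.smul_integral_comp_mul_left (a := 0) (b := (t : ℝ))
        (IccExtend zero_le_one (fun r : I => h z r (u z r))) (s : ℝ)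
      rw [mul_zero] at h3
      rw [← h3, ← intervalIntegral.integral_smul]
      refine intervalIntegral.integral_congr_ae (.of_forall fun r hr => ?_)
      rw [uIoc_of_le t.2.1] at hr
      have hr1 : r ∈ I := ⟨hr.1.le, hr.2.trans t.2.2⟩
      have hr2 : (s : ℝ) * r ∈ I := (s * ⟨r, hr1⟩ : I).2
      rw [IccExtend_of_mem _ _ hr1, IccExtend_of_mem _ _ hr2]
      have h4 := hhsz ⟨r, hr1⟩
      have h5 := hhz ⟨_, hr2⟩
      have h6 : h ((s : ℝ) • z) ⟨r, hr1⟩ = (s : ℝ) • h z ⟨_, hr2⟩ := by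
        refine smul_right_injective _ hr.1.ne' ?_
        change r • _ = r • _
        rw [smul_smul, mul_comm r]
        change r • _ = _ at h4
        change ((s : ℝ) * r) • _ = _ at h5
        rw [h4, h5, smul_smul, mul_comm r]
      rw [h6]
      rfl
    have := huniq _ hsz v hv
    change u _ 1 = _
    rw [← this]
    simp [v]
  have hgood := hunit.and (hhb.and hU.eventually_analyticAt)
  obtain ⟨ε, hε, hball⟩ := Metric.eventually_nhds_iff_ball.1 hgood
  have hscale : ∀ z ∈ Metric.ball (0 : E) ε, ∀ s : I, U ((s : ℝ) • z) = u z s := by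
    intro z hz s
    have hsz : (s : ℝ) • z ∈ Metric.ball (0 : E) ε := by
      rw [mem_ball_zero_iff] at hz ⊢
      rw [norm_smul, Real.norm_of_nonneg s.2.1]
      exact (mul_le_of_le_one_left (norm_nonneg z) s.2.2).trans_lt hz
    exact hray z (hball z hz).1 (hball z hz).2.1 s (hball _ hsz).1 (hball _ hsz).2.1
  filter_upwards [Metric.ball_mem_nhds (0 : E) (half_pos hε)] with x hx
  have hx' : (2 : ℝ) • x ∈ Metric.ball (0 : E) ε := by
    rw [mem_ball_zero_iff] at hx ⊢
    rw [norm_smul, Real.norm_of_nonneg zero_le_two]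
    linarith
  have hxx : ((2⁻¹ : ℝ) • (2 : ℝ) • x) = x := by simp [smul_smul]
  have hI : (2⁻¹ : ℝ) ∈ I := by constructor <;> norm_num
  have hxa : AnalyticAt ℝ U x := (hball x (Metric.ball_subset_ball (by linarith) hx)).2.2
  let g : ℝ → F := IccExtend zero_le_one fun s : I => h ((2 : ℝ) • x) s (u ((2 : ℝ) • x) s)
  have hg : Continuous g := continuous_IccExtend_apply _ _
  have hd1 : HasDerivAt (fun t : ℝ => u₀ + ∫ s in (0 : ℝ)..t, g s) (g 2⁻¹) 2⁻¹ :=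
    (intervalIntegral.integral_hasDerivAt_right (hg.intervalIntegrable _ _)
      (hg.stronglyMeasurableAtFilter _ _) hg.continuousAt).const_add u₀
  have hd2 : HasDerivAt (fun t : ℝ => U (t • (2 : ℝ) • x)) (fderiv ℝ U x ((2 : ℝ) • x)) 2⁻¹ := by
    have h1 : HasDerivAt (fun t : ℝ => t • (2 : ℝ) • x) ((1 : ℝ) • (2 : ℝ) • x) 2⁻¹ :=
      (hasDerivAt_id (2⁻¹ : ℝ)).smul_const _
    have h2 : HasFDerivAt U (fderiv ℝ U x) ((2⁻¹ : ℝ) • (2 : ℝ) • x) := by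
      rw [hxx]; exact hxa.differentiableAt.hasFDerivAt
    rw [one_smul] at h1
    exact h2.comp_hasDerivAt _ h1
  have heq : (fun t : ℝ => U (t • (2 : ℝ) • x)) =ᶠ[𝓝 2⁻¹] fun t => u₀ + ∫ s in (0 : ℝ)..t, g s := by
    filter_upwards [Icc_mem_nhds (show (0 : ℝ) < 2⁻¹ by norm_num) (show (2⁻¹ : ℝ) < 1 by norm_num)]
      with t ht
    have h1 := hscale _ hx' ⟨t, ht⟩
    rw [hsol _ (hball _ hx').1] at h1
    exact h1
  have hder := (hd1.congr_of_eventuallyEq heq).unique hd2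
  have h1 := (hball _ hx').2.1 ⟨_, hI⟩
  have h2 := hscale _ hx' ⟨_, hI⟩
  have h3 : g 2⁻¹ = h ((2 : ℝ) • x) ⟨_, hI⟩ (u ((2 : ℝ) • x) ⟨_, hI⟩) := IccExtend_of_mem _ _ hI
  simp only [hxx] at h1 h2
  rw [← h1, h2, smul_apply, ← h3, hder]
  rw [← map_smul, hxx]

/-- Analytic Frobenius theorem for flat linear connections: if `A` is analytic and satisfies the
zero curvature condition near the origin, then `DU(z) v = A(z)(v) U(z)` has an analytic solution
near the origin, with arbitrary initial value. -/
theorem exists_analyticAt_fderiv_eq_of_flat [CompleteSpace F] {A : E → E →L[ℝ] F →L[ℝ] F}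
    (hA : AnalyticAt ℝ A 0)
    (hflat : ∀ᶠ z in 𝓝 0, ∀ v w f, fderiv ℝ A z w v f + A z v (A z w f) =
      fderiv ℝ A z v w f + A z w (A z v f)) (u₀ : F) :
    ∃ U : E → F, AnalyticAt ℝ U 0 ∧ U 0 = u₀ ∧
      ∀ᶠ z in 𝓝 0, ∀ v, fderiv ℝ U z v = A z v (U z) := by
  obtain ⟨U, hU, hU0, hrad⟩ := exists_analyticAt_radial (b := fun z => A z z)
    (((ContinuousLinearMap.id ℝ (E →L[ℝ] F →L[ℝ] F)).analyticAt_bilinear (A 0, 0)).comp₂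
      hA analyticAt_id) (by simp) u₀
  refine ⟨U, hU, hU0, ?_⟩
  obtain ⟨ε, hε, hball⟩ := Metric.eventually_nhds_iff_ball.1
    (hflat.and (hrad.and (hA.eventually_analyticAt.and hU.eventually_analyticAt)))
  have hkey : ∀ y ∈ Metric.ball (0 : E) ε, ∀ v,
      fderiv ℝ (fderiv ℝ U) y y v + fderiv ℝ U y v =
        fderiv ℝ A y v y (U y) + A y v (U y) + A y y (fderiv ℝ U y v) := by
    intro y hy v
    obtain ⟨-, -, hAy, hUy⟩ := hball y hy
    have hsymm : fderiv ℝ (fderiv ℝ U) y y v = fderiv ℝ (fderiv ℝ U) y v y :=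
      (hUy.contDiffAt (n := 2)).isSymmSndFDerivAt (by simp) y v
    have hl := hUy.fderiv.differentiableAt.hasFDerivAt.clm_apply (hasFDerivAt_id y)
    have hr := (hAy.differentiableAt.hasFDerivAt.clm_apply (hasFDerivAt_id y)).clm_apply
      hUy.differentiableAt.hasFDerivAt
    have heq : (fun z => fderiv ℝ U z z) =ᶠ[𝓝 y] fun z => A z z (U z) := by
      filter_upwards [Metric.isOpen_ball.mem_nhds hy] with z hz using (hball z hz).2.1
    have := congrArg (fun L : E →L[ℝ] F => L v) ((hr.congr_of_eventuallyEq heq).unique hl)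
    simp only [ContinuousLinearMap.comp_id, add_apply, ContinuousLinearMap.comp_apply,
      ContinuousLinearMap.flip_apply, id_eq] at this
    rw [hsymm, add_comm, ← this]
    abel
  filter_upwards [Metric.ball_mem_nhds (0 : E) hε] with x hx v
  have hmem : ∀ s ∈ Icc (0 : ℝ) 1, s • x ∈ Metric.ball (0 : E) ε := by
    intro s hs
    rw [mem_ball_zero_iff] at hx ⊢
    rw [norm_smul, Real.norm_of_nonneg hs.1]
    exact (mul_le_of_le_one_left (norm_nonneg x) hs.2).trans_lt hx
  let g : ℝ → F := fun s => s • (fderiv ℝ U (s • x) v - A (s • x) v (U (s • x)))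
  have hg : ∀ s ∈ Icc (0 : ℝ) 1, HasDerivAt g (A (s • x) x (g s)) s := by
    intro s hs
    obtain ⟨hfl, hr, hAy, hUy⟩ := hball _ (hmem s hs)
    have hray : HasDerivAt (fun s : ℝ => s • x) x s := by
      simpa using (hasDerivAt_id s).smul_const x
    have h1 := hUy.fderiv.differentiableAt.hasFDerivAt.comp_hasDerivAt s hray
    have h2 := hAy.differentiableAt.hasFDerivAt.comp_hasDerivAt s hray
    have h3 := hUy.differentiableAt.hasFDerivAt.comp_hasDerivAt s hray
    have h4 := (hasDerivAt_id s).smul ((h1.clm_apply (hasDerivAt_const s v)).sub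
      ((h2.clm_apply (hasDerivAt_const s v)).clm_apply h3))
    refine h4.congr_deriv ?_
    have hk := hkey _ (hmem s hs) v
    have hf := hfl v (s • x) (U (s • x))
    rw [← hr] at hf
    simp only [map_smul, smul_apply] at hk hf
    simp only [id_eq, Function.comp_apply, map_zero, add_zero, one_smul, Pi.sub_apply,
      smul_sub, smul_add, map_sub, map_smul, g]
    rw [hf, eq_sub_of_add_eq hk]
    abel
  obtain ⟨K, hK⟩ := isCompact_Icc.exists_bound_of_continuousOn (s := Icc (0 : ℝ) 1)
    (f := fun s => A (s • x) x) (fun s hs => by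
      have h1 : ContinuousAt A (s • x) := (hball _ (hmem s hs)).2.2.1.continuousAt
      have h2 : ContinuousAt (fun s : ℝ => A (s • x)) s :=
        ContinuousAt.comp' (f := fun s : ℝ => s • x) h1 (by fun_prop)
      exact (h2.clm_apply continuousAt_const).continuousWithinAt)
  have h0 := eq_zero_of_abs_deriv_le_mul_abs_self_of_eq_zero_right (f := g) (K := K)
    (fun s hs => (hg s hs).continuousAt.continuousWithinAt)
    (fun s hs => (hg s (Ico_subset_Icc_self hs)).hasDerivWithinAt) (by simp [g])
    (fun s hs => (A (s • x) x).le_of_opNorm_le (hK s (Ico_subset_Icc_self hs)) _)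
    1 (right_mem_Icc.2 zero_le_one)
  simpa [g, sub_eq_zero] using h0

/-- The connection on pairs `(p, c)` of a covector and a scalar whose parallel sections are the pairs
`(DZ, Z)` with `D²Z = DZ ∘ Γ`; it depends affinely on `Γ`, and this is its linear part. -/
noncomputable def jetConnection (E : Type*) [NormedAddCommGroup E] [NormedSpace ℝ E] :
    (E →L[ℝ] E →L[ℝ] E) →L[ℝ] E →L[ℝ] ((E →L[ℝ] ℝ) × ℝ) →L[ℝ] ((E →L[ℝ] ℝ) × ℝ) :=
  ContinuousLinearMap.compL ℝ E (E →L[ℝ] E) _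
    (ContinuousLinearMap.compL ℝ ((E →L[ℝ] ℝ) × ℝ) (E →L[ℝ] ℝ) ((E →L[ℝ] ℝ) × ℝ)
        (ContinuousLinearMap.inl ℝ (E →L[ℝ] ℝ) ℝ) ∘L
      (ContinuousLinearMap.compL ℝ ((E →L[ℝ] ℝ) × ℝ) (E →L[ℝ] ℝ) (E →L[ℝ] ℝ)).flip
        (ContinuousLinearMap.fst ℝ (E →L[ℝ] ℝ) ℝ) ∘L
      (ContinuousLinearMap.compL ℝ E E ℝ).flip)

/-- The constant part of the connection whose linear part is `jetConnection`. -/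
noncomputable def jetConnectionConst (E : Type*) [NormedAddCommGroup E] [NormedSpace ℝ E] :
    E →L[ℝ] ((E →L[ℝ] ℝ) × ℝ) →L[ℝ] ((E →L[ℝ] ℝ) × ℝ) :=
  ContinuousLinearMap.compL ℝ ((E →L[ℝ] ℝ) × ℝ) ℝ ((E →L[ℝ] ℝ) × ℝ)
      (ContinuousLinearMap.inr ℝ (E →L[ℝ] ℝ) ℝ) ∘L
    (ContinuousLinearMap.compL ℝ ((E →L[ℝ] ℝ) × ℝ) (E →L[ℝ] ℝ) ℝ).flip
      (ContinuousLinearMap.fst ℝ (E →L[ℝ] ℝ) ℝ) ∘L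
    ContinuousLinearMap.apply ℝ ℝ

lemma jetConnection_apply (Γ : E →L[ℝ] E →L[ℝ] E) (v : E) (f : (E →L[ℝ] ℝ) × ℝ) :
    jetConnection E Γ v f = (f.1 ∘L Γ v, 0) := rfl

lemma jetConnectionConst_apply (v : E) (f : (E →L[ℝ] ℝ) × ℝ) :
    jetConnectionConst E v f = (0, f.1 v) := rfl

/-- Affine functions of a flat torsion-free analytic connection: there is an analytic solution of
`D²Z = DZ ∘ Γ` near the origin with arbitrary first derivative at the origin. -/
theorem exists_analyticAt_fderiv_fderiv_eq [CompleteSpace E] {Γ : E → E →L[ℝ] E →L[ℝ] E} (hΓ : AnalyticAt ℝ Γ 0)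
    (hsymm : ∀ᶠ z in 𝓝 0, ∀ v w, Γ z v w = Γ z w v)
    (hflat : ∀ᶠ z in 𝓝 0, ∀ v w u, fderiv ℝ Γ z w v u + Γ z w (Γ z v u) =
      fderiv ℝ Γ z v w u + Γ z v (Γ z w u)) (p₀ : E →L[ℝ] ℝ) :
    ∃ Z : E → ℝ, AnalyticAt ℝ Z 0 ∧ fderiv ℝ Z 0 = p₀ ∧
      ∀ᶠ z in 𝓝 0, ∀ v w, fderiv ℝ (fderiv ℝ Z) z v w = fderiv ℝ Z z (Γ z v w) := by
  let A : E → E →L[ℝ] ((E →L[ℝ] ℝ) × ℝ) →L[ℝ] ((E →L[ℝ] ℝ) × ℝ) := fun z =>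
    jetConnection E (Γ z) + jetConnectionConst E
  have hA : AnalyticAt ℝ A 0 :=
    (((jetConnection E).analyticAt (Γ 0)).fun_comp hΓ).add analyticAt_const
  have hAflat : ∀ᶠ z in 𝓝 0, ∀ v w f, fderiv ℝ A z w v f + A z v (A z w f) =
      fderiv ℝ A z v w f + A z w (A z v f) := by
    filter_upwards [hsymm, hflat, hΓ.eventually_analyticAt] with z hs hf hz v w f
    have hd : fderiv ℝ A z = jetConnection E ∘L fderiv ℝ Γ z :=
      (((jetConnection E).hasFDerivAt.comp z hz.differentiableAt.hasFDerivAt).add_const _).fderiv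
    rw [hd]
    refine Prod.ext (ContinuousLinearMap.ext fun u => ?_) ?_
    · simpa [A, jetConnection_apply, jetConnectionConst_apply] using congrArg f.1 (hf v w u)
    · simp [A, jetConnection_apply, jetConnectionConst_apply, hs v w]
  obtain ⟨U, hU, hU0, hUA⟩ := exists_analyticAt_fderiv_eq_of_flat hA hAflat (p₀, 0)
  have hZ : (fderiv ℝ fun z => (U z).2) =ᶠ[𝓝 0] fun z => (U z).1 := by
    filter_upwards [hUA, hU.eventually_analyticAt] with z hz hUz
    ext v
    have := (hasFDerivAt_snd.comp z hUz.differentiableAt.hasFDerivAt).fderiv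
    change fderiv ℝ (fun z => (U z).2) z = _ at this
    rw [this]
    simp [hz, A, jetConnection_apply, jetConnectionConst_apply]
  refine ⟨fun z => (U z).2, analyticAt_snd.fun_comp hU, ?_, ?_⟩
  · rw [hZ.eq_of_nhds, hU0]
  · filter_upwards [hUA, hU.eventually_analyticAt, hZ.eventually_nhds] with z hz hUz hZz v w
    replace hZz : (fderiv ℝ fun z => (U z).2) =ᶠ[𝓝 z] fun z => (U z).1 := hZz
    have := (hasFDerivAt_fst.comp z hUz.differentiableAt.hasFDerivAt).fderiv
    change fderiv ℝ (fun z => (U z).1) z = _ at this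
    rw [hZz.fderiv_eq, this, hZz.eq_of_nhds]
    simp [hz, A, jetConnection_apply, jetConnectionConst_apply]

end AnalyticODE

lemma AnalyticAt.pd {m : ℕ} {f : (Fin (m + 1) → ℝ) → ℝ} {z : Fin (m + 1) → ℝ}
    (hf : AnalyticAt ℝ f z) (i : Fin (m + 1)) : AnalyticAt ℝ (pd m i f) z :=
  ((ContinuousLinearMap.apply ℝ ℝ (Pi.single i 1 : Fin (m + 1) → ℝ)).analyticAt
    (fderiv ℝ f z)).fun_comp hf.fderiv

lemma pd_pd_eq_fderiv_fderiv {m : ℕ} {f : (Fin (m + 1) → ℝ) → ℝ} {z : Fin (m + 1) → ℝ}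
    (hf : AnalyticAt ℝ f z) (i j : Fin (m + 1)) :
    pd m i (pd m j f) z = fderiv ℝ (fderiv ℝ f) z (Pi.single i 1) (Pi.single j 1) := by
  have h := hf.fderiv.differentiableAt.hasFDerivAt.clm_apply
    (hasFDerivAt_const (Pi.single j 1 : Fin (m + 1) → ℝ) z)
  change fderiv ℝ (fun z => fderiv ℝ f z (Pi.single j 1)) z (Pi.single i 1) = _
  rw [h.fderiv]
  simp

lemma pd_comm {m : ℕ} {f : (Fin (m + 1) → ℝ) → ℝ} {z : Fin (m + 1) → ℝ}
    (hf : AnalyticAt ℝ f z) (i j : Fin (m + 1)) :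
    pd m i (pd m j f) z = pd m j (pd m i f) z := by
  rw [pd_pd_eq_fderiv_fderiv hf, pd_pd_eq_fderiv_fderiv hf]
  exact (hf.contDiffAt (n := 2)).isSymmSndFDerivAt (by simp) _ _

lemma pd_congr {m : ℕ} {f g : (Fin (m + 1) → ℝ) → ℝ} {z : Fin (m + 1) → ℝ}
    (h : f =ᶠ[nhds z] g) (i : Fin (m + 1)) : pd m i f z = pd m i g z := by
  simp only [pd, h.fderiv_eq]

lemma pd_sum_mul {m : ℕ} {f g : Fin (m + 1) → (Fin (m + 1) → ℝ) → ℝ} {z : Fin (m + 1) → ℝ}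
    (hf : ∀ k, AnalyticAt ℝ (f k) z) (hg : ∀ k, AnalyticAt ℝ (g k) z) (i : Fin (m + 1)) :
    pd m i (fun x => ∑ k, f k x * g k x) z =
      ∑ k, (f k z * pd m i (g k) z + g k z * pd m i (f k) z) := by
  have h : HasFDerivAt (fun x => ∑ k, f k x * g k x)
      (∑ k, (f k z • fderiv ℝ (g k) z + g k z • fderiv ℝ (f k) z)) z :=
    HasFDerivAt.fun_sum fun k _ =>
      (hf k).differentiableAt.hasFDerivAt.mul (hg k).differentiableAt.hasFDerivAt
  change fderiv ℝ _ z (Pi.single i 1) = _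
  rw [h.fderiv]
  simp [pd]

/-- Cramer's rule: the square functions are the coefficients of the second derivatives with
respect to the first derivatives. -/
lemma sqFn_eq_iff {m : ℕ} {Z : Fin (m + 1) → (Fin (m + 1) → ℝ) → ℝ} {z : Fin (m + 1) → ℝ}
    (hJ : jacDet m Z z ≠ 0) (l₁ l₂ : Fin (m + 1)) (p : Fin (m + 1) → ℝ) :
    (∀ k, sqFn m Z k l₁ l₂ z = p k) ↔
      ∀ i, pd m l₂ (pd m l₁ (Z i)) z = ∑ k, p k * pd m k (Z i) z := by
  set J : Matrix (Fin (m + 1)) (Fin (m + 1)) ℝ := Matrix.of fun i j => pd m j (Z i) z with hJdef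
  set b : Fin (m + 1) → ℝ := fun i => pd m l₂ (pd m l₁ (Z i)) z with hb
  have hdet : J.det ≠ 0 := hJ
  have hsq : ∀ k, sqFn m Z k l₁ l₂ z = J.cramer b k / J.det := by
    intro k
    rw [sqFn, jacDetRep, Matrix.cramer_apply]
    congr 2
    ext i j
    simp [Matrix.updateCol_apply, hJdef, hb]
  have hmul : (∀ i, pd m l₂ (pd m l₁ (Z i)) z = ∑ k, p k * pd m k (Z i) z) ↔
      b = J.mulVec p := by
    simp [funext_iff, Matrix.mulVec, dotProduct, hJdef, hb, mul_comm]
  rw [hmul]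
  constructor
  · intro h
    have hc : J.cramer b = J.det • p := by
      ext k
      rw [Pi.smul_apply, smul_eq_mul, ← h k, hsq, mul_div_cancel₀ _ hdet]
    have := J.mulVec_cramer b
    rw [hc, Matrix.mulVec_smul] at this
    exact (smul_right_injective _ hdet this).symm
  · intro h k
    rw [hsq, h, Matrix.cramer_eq_adjugate_mulVec, Matrix.mulVec_mulVec, Matrix.adjugate_mul,
      Matrix.smul_mulVec, Matrix.one_mulVec, Pi.smul_apply, smul_eq_mul,
      mul_div_cancel_left₀ _ hdet]

/-- The compatibility conditions follow from the symmetry of third derivatives. -/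
lemma compatibility_of_pd_pd_eq {m : ℕ} {P : Fin (m + 1) → Fin (m + 1) → Fin (m + 1) →
      (Fin (m + 1) → ℝ) → ℝ} {Z : Fin (m + 1) → (Fin (m + 1) → ℝ) → ℝ} {z : Fin (m + 1) → ℝ}
    (hsym : ∀ j l₁ l₂, P j l₁ l₂ = P j l₂ l₁)
    (hP : ∀ j l₁ l₂, AnalyticAt ℝ (P j l₁ l₂) z) (hZ : ∀ i, AnalyticAt ℝ (Z i) z)
    (hJ : jacDet m Z z ≠ 0)
    (h : ∀ i l₁ l₂, ∀ᶠ x in nhds z, pd m l₂ (pd m l₁ (Z i)) x = ∑ k, P k l₁ l₂ x * pd m k (Z i) x)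
    (j l₁ l₂ l₃ : Fin (m + 1)) :
    pd m l₃ (P j l₁ l₂) z - pd m l₂ (P j l₁ l₃) z =
      -(∑ k : Fin (m + 1), P k l₁ l₂ z * P j l₃ k z) +
        ∑ k : Fin (m + 1), P k l₁ l₃ z * P j l₂ k z := by
  let c : Fin (m + 1) → Fin (m + 1) → Fin (m + 1) → ℝ := fun l₂ l₃ j =>
    pd m l₃ (P j l₁ l₂) z + ∑ k, P k l₁ l₂ z * P j l₃ k z
  have hthird : ∀ i l₂ l₃, pd m l₃ (pd m l₂ (pd m l₁ (Z i))) z = ∑ j, pd m j (Z i) z * c l₂ l₃ j := by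
    intro i l₂ l₃
    rw [pd_congr (h i l₁ l₂) l₃, pd_sum_mul (fun k => hP k l₁ l₂) (fun k => (hZ i).pd k)]
    simp only [(h i _ l₃).self_of_nhds, c, mul_add, Finset.sum_add_distrib, Finset.mul_sum]
    rw [add_comm, Finset.sum_comm]
    congr 1
    refine Finset.sum_congr rfl fun j _ => Finset.sum_congr rfl fun k _ => ?_
    rw [hsym j l₃ k]
    ring
  have hc : c l₂ l₃ - c l₃ l₂ = 0 := by
    refine Matrix.eq_zero_of_mulVec_eq_zero
      (M := Matrix.of fun i j => pd m j (Z i) z) hJ (funext fun i => ?_)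
    have h1 := pd_comm ((hZ i).pd l₁) l₃ l₂
    rw [hthird, hthird] at h1
    simp [Matrix.mulVec, dotProduct, mul_sub, Finset.sum_sub_distrib, h1]
  have := congrFun hc j
  simp only [c, Pi.sub_apply, Pi.zero_apply] at this
  linear_combination this

section Connection

set_option maxSynthPendingDepth 3

variable {m : ℕ}

/-- The vector-valued bilinear map with coefficients `P j l₁ l₂ z`. -/
noncomputable def connectionOf (P : Fin (m + 1) → Fin (m + 1) → Fin (m + 1) →
    (Fin (m + 1) → ℝ) → ℝ) (z : Fin (m + 1) → ℝ) :
    (Fin (m + 1) → ℝ) →L[ℝ] (Fin (m + 1) → ℝ) →L[ℝ] (Fin (m + 1) → ℝ) :=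
  ∑ j, ∑ l₁, ∑ l₂, P j l₁ l₂ z •
    (ContinuousLinearMap.proj (R := ℝ) (φ := fun _ : Fin (m + 1) => ℝ) l₁).smulRight
      ((ContinuousLinearMap.proj (R := ℝ) (φ := fun _ : Fin (m + 1) => ℝ) l₂).smulRight
        (Pi.single j 1 : Fin (m + 1) → ℝ))

lemma connectionOf_single (P : Fin (m + 1) → Fin (m + 1) → Fin (m + 1) →
    (Fin (m + 1) → ℝ) → ℝ) (z : Fin (m + 1) → ℝ) (l₁ l₂ : Fin (m + 1)) :
    connectionOf P z (Pi.single l₁ 1) (Pi.single l₂ 1) = fun j => P j l₁ l₂ z := by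
  ext j
  simp [connectionOf, Finset.sum_apply, Pi.single_apply]

lemma connectionOf_single_apply (P : Fin (m + 1) → Fin (m + 1) → Fin (m + 1) →
    (Fin (m + 1) → ℝ) → ℝ) (z : Fin (m + 1) → ℝ) (l₁ : Fin (m + 1)) (v : Fin (m + 1) → ℝ) :
    connectionOf P z (Pi.single l₁ 1) v = fun j => ∑ l₂, v l₂ * P j l₁ l₂ z := by
  ext j
  simp [connectionOf, Finset.sum_apply, Pi.single_apply, mul_comm]

lemma AnalyticAt.connectionOf {P : Fin (m + 1) → Fin (m + 1) → Fin (m + 1) →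
    (Fin (m + 1) → ℝ) → ℝ} {z : Fin (m + 1) → ℝ} (hP : ∀ j l₁ l₂, AnalyticAt ℝ (P j l₁ l₂) z) :
    AnalyticAt ℝ (connectionOf P) z := by
  refine Finset.analyticAt_fun_sum _ fun j _ => Finset.analyticAt_fun_sum _ fun l₁ _ =>
    Finset.analyticAt_fun_sum _ fun l₂ _ => (hP j l₁ l₂).smul analyticAt_const

lemma fderiv_connectionOf_single {P : Fin (m + 1) → Fin (m + 1) → Fin (m + 1) →
    (Fin (m + 1) → ℝ) → ℝ} {z : Fin (m + 1) → ℝ} (hP : ∀ j l₁ l₂, AnalyticAt ℝ (P j l₁ l₂) z)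
    (l₁ l₂ l₃ : Fin (m + 1)) :
    fderiv ℝ (connectionOf P) z (Pi.single l₃ 1) (Pi.single l₁ 1) (Pi.single l₂ 1) =
      fun j => pd m l₃ (P j l₁ l₂) z := by
  ext j
  have h := ((AnalyticAt.connectionOf hP).differentiableAt.hasFDerivAt.clm_apply
    (hasFDerivAt_const (Pi.single l₁ 1 : Fin (m + 1) → ℝ) z)).clm_apply
    (hasFDerivAt_const (Pi.single l₂ 1 : Fin (m + 1) → ℝ) z)
  have h2 := (ContinuousLinearMap.proj (R := ℝ) (φ := fun _ : Fin (m + 1) => ℝ) j).hasFDerivAt.comp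
    z h
  have h3 : P j l₁ l₂ = (ContinuousLinearMap.proj (R := ℝ) (φ := fun _ : Fin (m + 1) => ℝ) j) ∘
      fun x => connectionOf P x (Pi.single l₁ 1) (Pi.single l₂ 1) := by
    ext x
    simp [connectionOf_single]
  change _ = fderiv ℝ (P j l₁ l₂) z (Pi.single l₃ 1)
  rw [h3, h2.fderiv]
  simp

/-- A continuous trilinear map vanishing on the standard basis vanishes. -/
lemma trilinear_eq_zero {ι G : Type*} [Fintype ι] [DecidableEq ι] [NormedAddCommGroup G]
    [NormedSpace ℝ G] (T : (ι → ℝ) →L[ℝ] (ι → ℝ) →L[ℝ] (ι → ℝ) →L[ℝ] G)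
    (hT : ∀ i j k, T (Pi.single i 1) (Pi.single j 1) (Pi.single k 1) = 0) : T = 0 := by
  refine (ContinuousLinearMap.coe_injective) (LinearMap.pi_ext' fun i => LinearMap.ext_ring ?_)
  refine (ContinuousLinearMap.coe_injective) (LinearMap.pi_ext' fun j => LinearMap.ext_ring ?_)
  refine (ContinuousLinearMap.coe_injective) (LinearMap.pi_ext' fun k => LinearMap.ext_ring ?_)
  simpa using hT i j k

lemma connectionOf_comm {P : Fin (m + 1) → Fin (m + 1) → Fin (m + 1) → (Fin (m + 1) → ℝ) → ℝ}
    (hsym : ∀ j l₁ l₂, P j l₁ l₂ = P j l₂ l₁) (z v w : Fin (m + 1) → ℝ) :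
    connectionOf P z v w = connectionOf P z w v := by
  have h : connectionOf P z = (connectionOf P z).flip := by
    refine (ContinuousLinearMap.coe_injective) (LinearMap.pi_ext' fun i => LinearMap.ext_ring ?_)
    refine (ContinuousLinearMap.coe_injective) (LinearMap.pi_ext' fun j => LinearMap.ext_ring ?_)
    ext k
    simp [connectionOf_single, hsym k i j]
  exact congrArg (fun T => T v w) h

lemma connectionOf_flat {P : Fin (m + 1) → Fin (m + 1) → Fin (m + 1) → (Fin (m + 1) → ℝ) → ℝ}
    {z : Fin (m + 1) → ℝ} (hsym : ∀ j l₁ l₂, P j l₁ l₂ = P j l₂ l₁)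
    (hP : ∀ j l₁ l₂, AnalyticAt ℝ (P j l₁ l₂) z)
    (hcomp : ∀ j l₁ l₂ l₃, pd m l₃ (P j l₁ l₂) z - pd m l₂ (P j l₁ l₃) z =
      -(∑ k : Fin (m + 1), P k l₁ l₂ z * P j l₃ k z) +
        ∑ k : Fin (m + 1), P k l₁ l₃ z * P j l₂ k z) (v w u : Fin (m + 1) → ℝ) :
    fderiv ℝ (connectionOf P) z w v u + connectionOf P z w (connectionOf P z v u) =
      fderiv ℝ (connectionOf P) z v w u + connectionOf P z v (connectionOf P z w u) := by
  let D := fderiv ℝ (connectionOf P) z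
  let C := (ContinuousLinearMap.compL ℝ (Fin (m + 1) → ℝ) (Fin (m + 1) → ℝ)
    (Fin (m + 1) → ℝ)).bilinearComp (connectionOf P z) (connectionOf P z)
  have hT : D + C - D.flip - C.flip = 0 := by
    refine trilinear_eq_zero _ fun l₃ l₂ l₁ => funext fun j => ?_
    have h := hcomp j l₁ l₂ l₃
    simp only [D, C, sub_apply, add_apply, ContinuousLinearMap.flip_apply,
      ContinuousLinearMap.bilinearComp_apply, ContinuousLinearMap.compL_apply,
      ContinuousLinearMap.comp_apply, fderiv_connectionOf_single hP, connectionOf_single,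
      Pi.add_apply, Pi.sub_apply, Pi.zero_apply, hsym _ l₂ l₁, hsym _ l₃ l₁]
    simp only [connectionOf_single_apply]
    linear_combination h
  have := congrArg (fun T => T w v u) hT
  simp only [D, C, sub_apply, add_apply, ContinuousLinearMap.flip_apply,
    ContinuousLinearMap.bilinearComp_apply, ContinuousLinearMap.compL_apply,
    ContinuousLinearMap.comp_apply, zero_apply] at this
  rw [sub_sub, sub_eq_zero] at this
  exact this

end Connection

/-- Solvability of the first auxiliary system: given symmetric real-analytic data
`Π^j_{l₁,l₂}` near `0`, there exists a point transformation `(X, Y¹, …, Y^m)` with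
nonvanishing Jacobian whose square functions equal the `Π`'s if and only if the
`Π`'s satisfy the quadratic compatibility conditions. -/
theorem first_auxiliary_system_solvable_iff (m : ℕ) (hm : 1 ≤ m)
    (P : Fin (m + 1) → Fin (m + 1) → Fin (m + 1) → (Fin (m + 1) → ℝ) → ℝ)
    (hsym : ∀ j l₁ l₂, P j l₁ l₂ = P j l₂ l₁)
    (W : Set (Fin (m + 1) → ℝ)) (hW : W ∈ nhds (0 : Fin (m + 1) → ℝ))
    (hP : ∀ j l₁ l₂, AnalyticOnNhd ℝ (P j l₁ l₂) W) :
    (∃ V ∈ nhds (0 : Fin (m + 1) → ℝ),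
      ∃ Z : Fin (m + 1) → (Fin (m + 1) → ℝ) → ℝ,
        (∀ i, AnalyticOnNhd ℝ (Z i) V) ∧
        (∀ z ∈ V, jacDet m Z z ≠ 0) ∧
        ∀ (j l₁ l₂ : Fin (m + 1)), ∀ z ∈ V, sqFn m Z j l₁ l₂ z = P j l₁ l₂ z)
    ↔
    (∃ W' ∈ nhds (0 : Fin (m + 1) → ℝ),
      ∀ (j l₁ l₂ l₃ : Fin (m + 1)), ∀ z ∈ W',
        pd m l₃ (P j l₁ l₂) z - pd m l₂ (P j l₁ l₃) z =
          -(∑ k : Fin (m + 1), P k l₁ l₂ z * P j l₃ k z) +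
            ∑ k : Fin (m + 1), P k l₁ l₃ z * P j l₂ k z) := by
  have hWn : ∀ᶠ z in nhds (0 : Fin (m + 1) → ℝ), ∀ j l₁ l₂, AnalyticAt ℝ (P j l₁ l₂) z :=
    Filter.mem_of_superset hW fun z hz j l₁ l₂ => hP j l₁ l₂ z hz
  constructor
  · rintro ⟨V, hV, Z, hZ, hJ, hsq⟩
    have hV' : ∀ᶠ z in nhds (0 : Fin (m + 1) → ℝ), z ∈ V := hV
    refine ⟨_, hWn.and hV'.eventually_nhds, ?_⟩
    rintro j l₁ l₂ l₃ z ⟨hPz, hVz⟩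
    have hz := hVz.self_of_nhds
    refine compatibility_of_pd_pd_eq hsym hPz (fun i => hZ i z hz) (hJ z hz) (fun i l₁ l₂ => ?_)
      j l₁ l₂ l₃
    filter_upwards [hVz] with x hx
    exact (sqFn_eq_iff (hJ x hx) l₁ l₂ _).1 (fun k => hsq k l₁ l₂ x hx) i
  · rintro ⟨W', hW', hcomp⟩
    have hW'n : ∀ᶠ z in nhds (0 : Fin (m + 1) → ℝ), z ∈ W' := hW'
    have hex := fun i : Fin (m + 1) => exists_analyticAt_fderiv_fderiv_eq
      (AnalyticAt.connectionOf hWn.self_of_nhds)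
      (.of_forall fun z => connectionOf_comm hsym z)
      (by
        filter_upwards [hWn, hW'n] with z hz hz'
        exact connectionOf_flat hsym hz fun j l₁ l₂ l₃ => hcomp j l₁ l₂ l₃ z hz')
      (ContinuousLinearMap.proj (R := ℝ) (φ := fun _ : Fin (m + 1) => ℝ) i)
    choose Z hZ hZ0 hZeq using hex
    have hJ0 : jacDet m Z 0 = 1 := by
      have : (Matrix.of fun i j => pd m j (Z i) 0) = 1 := by
        ext i j
        simp [pd, hZ0, Matrix.one_apply, Pi.single_apply]
      rw [jacDet, this, Matrix.det_one]
    have hJc : ContinuousAt (jacDet m Z) 0 := by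
      refine (Continuous.matrix_det continuous_id).continuousAt.comp
        (f := fun z => Matrix.of fun i j => pd m j (Z i) z) ?_
      exact continuousAt_pi.2 fun i => continuousAt_pi.2 fun j => ((hZ i).pd j).continuousAt
    refine ⟨_, (Filter.eventually_all.2 fun i => (hZ i).eventually_analyticAt).and
      ((hJc.eventually_ne (hJ0 ▸ one_ne_zero)).and (Filter.eventually_all.2 hZeq)), Z, ?_, ?_, ?_⟩
    · exact fun i z hz => hz.1 i
    · exact fun z hz => hz.2.1
    · intro j l₁ l₂ z hz
      refine (sqFn_eq_iff hz.2.1 l₁ l₂ fun k => P k l₁ l₂ z).2 (fun i => ?_) j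
      rw [pd_pd_eq_fderiv_fderiv (hz.1 i), hz.2.2 i, connectionOf_single]
      have hb : (fun j => P j l₂ l₁ z) = ∑ k, P k l₁ l₂ z • (Pi.single k 1 : Fin (m + 1) → ℝ) := by
        ext k
        simp [Finset.sum_apply, Pi.single_apply, hsym k l₁ l₂]
      rw [hb, map_sum]
      simp [pd]
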